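/- arXiv:1807.11648 — 3 statements merged into one kernel-verified Lean document; each statement's English description precedes it below -/
import Mathlib

section
/- There exist universal constants C, C' > 0 such that for every pair of integers 2 ≤ k ≤ d and every finite set V ⊆ ℝ^d there exists a subset U ⊆ V with |U| ≤ C·k·log² k such that U is a (C'·k·log³ k)-spectral k-spanner of V. -/
open Matrix Finset
noncomputable section
/-- The outer product `v vᵀ` as a `d × d` real matrix. -/
def outer {d : ℕ} (v : Fin d → ℝ) : Matrix (Fin d) (Fin d) ℝ := Matrix.vecMulVec v v

/-- The Frobenius (trace) inner product of two real matrices. -/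
def frob {d : ℕ} (A B : Matrix (Fin d) (Fin d) ℝ) : ℝ := ∑ i, ∑ j, A i j * B i j

/-- `A ⪯_k B` : `⟨A, Π⟩ ≤ ⟨B, Π⟩` for every orthogonal projection matrix `Π`
(symmetric and idempotent) of rank `d - k + 1`. -/
def PrecK {d : ℕ} (k : ℕ) (A B : Matrix (Fin d) (Fin d) ℝ) : Prop :=
  ∀ P : Matrix (Fin d) (Fin d) ℝ, P.IsHermitian → P * P = P → P.rank = d - k + 1 →
    frob A P ≤ frob B P

/-- `U` is an `α`-spectral `k`-spanner of `V`: `U ⊆ V` and for every `v ∈ V` there is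
a probability distribution `μ` on `U` with `v vᵀ ⪯_k α · ∑_{u ∈ U} μ(u) u uᵀ`. -/
def IsSpectralKSpanner {d : ℕ} (k : ℕ) (α : ℝ) (V U : Finset (Fin d → ℝ)) : Prop :=
  U ⊆ V ∧ ∀ v ∈ V, ∃ μ : (Fin d → ℝ) → ℝ,
    (∀ u, 0 ≤ μ u) ∧ (∑ u ∈ U, μ u) = 1 ∧
    PrecK k (outer v) (α • ∑ u ∈ U, μ u • outer u)


lemma hadamard_aux {m : ℕ} (N : Matrix (Fin m) (Fin m) ℝ) :
    N.det ^ 2 ≤ ∏ i, ∑ a, N a i ^ 2 := by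
  let b := EuclideanSpace.basisFun (Fin m) ℝ
  have : Fact (Module.finrank ℝ (EuclideanSpace ℝ (Fin m)) = m) := ⟨by simp⟩
  let o := b.toBasis.orientation
  have h := o.abs_volumeForm_apply_le (fun i => WithLp.toLp 2 (fun a => N a i))
  rw [o.volumeForm_robust b rfl, Module.Basis.det_apply] at h
  have hN : b.toBasis.toMatrix (fun i => WithLp.toLp 2 (fun a => N a i)) = N := by
    ext i j
    simp [b, Module.Basis.toMatrix_apply]
  rw [hN] at h
  have h2 : |N.det| ^ 2 ≤ (∏ i : Fin m, ‖(WithLp.toLp 2 (fun a => N a i) : EuclideanSpace ℝ (Fin m))‖) ^ 2 := by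
    gcongr
  rw [sq_abs, ← Finset.prod_pow] at h2
  refine h2.trans (le_of_eq (Finset.prod_congr rfl fun i _ => ?_))
  simp [EuclideanSpace.norm_sq_eq]

lemma sumsq_eq_trace {m : ℕ} (E : Matrix (Fin m) (Fin m) ℝ) :
    ∑ i, ∑ a, E a i ^ 2 = (E * Eᵀ).trace := by
  rw [Finset.sum_comm]
  simp [Matrix.trace, Matrix.mul_apply, sq]

lemma sumsq_orth {m : ℕ} (E O : Matrix (Fin m) (Fin m) ℝ) (hO : O * Oᵀ = 1) :
    ∑ i, ∑ a, (E * O) a i ^ 2 = ∑ i, ∑ a, E a i ^ 2 := by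
  rw [sumsq_eq_trace, sumsq_eq_trace, Matrix.transpose_mul, Matrix.mul_assoc, ← Matrix.mul_assoc O,
    hO, Matrix.one_mul]

lemma rank_lemma {m r : ℕ} (hm : 1 ≤ m) (T M : Matrix (Fin m) (Fin m) ℝ)
    (htri : ∀ i j, j < i → T i j = 0) (hdiag : ∀ i, T i i = 1) (hle : ∀ i j, T i j ^ 2 ≤ 1)
    (hrank : M.rank ≤ r) (hE : ∑ i, ∑ a, (T - M) a i ^ 2 ≤ (m : ℝ) / 4) :
    (3 / 4 : ℝ) * m ≤ r * (1 + 2 * Real.log m) := by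
  have hH : (Mᵀ * M).IsHermitian := by
    rw [← Matrix.conjTranspose_eq_transpose_of_trivial]
    exact Matrix.isHermitian_conjTranspose_mul_self M
  let O : Matrix (Fin m) (Fin m) ℝ := hH.eigenvectorUnitary
  have hO : O * Oᵀ = 1 := by
    have := (Matrix.mem_unitaryGroup_iff).1 hH.eigenvectorUnitary.2
    rwa [Matrix.star_eq_conjTranspose, Matrix.conjTranspose_eq_transpose_of_trivial] at this
  let Z : Finset (Fin m) := univ.filter fun i => hH.eigenvalues i = 0
  have hZc : (Zᶜ).card ≤ r := by
    have h1 := hH.rank_eq_card_non_zero_eigs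
    rw [Matrix.rank_transpose_mul_self, Fintype.card_subtype] at h1
    have : Zᶜ = univ.filter fun i => hH.eigenvalues i ≠ 0 := by
      ext i; simp [Z]
    rw [this]; omega
  have hcard : (Z.card : ℝ) + (Zᶜ).card = m := by
    have := Finset.card_add_card_compl Z
    rw [Fintype.card_fin] at this
    exact_mod_cast this
  have hker : ∀ i ∈ Z, ∀ a, (M * O) a i = 0 := by
    intro i hi a
    have h0 : hH.eigenvalues i = 0 := by simpa [Z] using hi
    have h1 := hH.mulVec_eigenvectorBasis i
    rw [h0, zero_smul, ← Matrix.mulVec_mulVec] at h1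
    have h2 : M *ᵥ (hH.eigenvectorBasis i).ofLp = 0 := by
      have h3 : (M *ᵥ (hH.eigenvectorBasis i).ofLp) ⬝ᵥ (M *ᵥ (hH.eigenvectorBasis i).ofLp) = 0 := by
        conv_lhs => rw [Matrix.dotProduct_mulVec, ← Matrix.mulVec_transpose, h1, zero_dotProduct]
      exact dotProduct_self_eq_zero.1 h3
    have := congrFun h2 a
    simpa [Matrix.mul_apply, Matrix.mulVec, dotProduct, O, Matrix.IsHermitian.eigenvectorUnitary_apply] using this
  have hcol : ∀ i ∈ Z, ∑ a, (T * O) a i ^ 2 = ∑ a, ((T - M) * O) a i ^ 2 := by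
    intro i hi
    refine Finset.sum_congr rfl fun a _ => ?_
    rw [Matrix.sub_mul, Matrix.sub_apply, hker i hi a, sub_zero]
  have hmpos : (1 : ℝ) ≤ m := by exact_mod_cast hm
  have hT : ∑ i, ∑ a, T a i ^ 2 ≤ (m : ℝ) ^ 2 := by
    calc ∑ i, ∑ a, T a i ^ 2 ≤ ∑ i : Fin m, ∑ a : Fin m, (1 : ℝ) :=
          Finset.sum_le_sum fun i _ => Finset.sum_le_sum fun a _ => hle a i
      _ = (m : ℝ) ^ 2 := by simp [sq]
  have hnn : ∀ (A : Matrix (Fin m) (Fin m) ℝ) i, 0 ≤ ∑ a, A a i ^ 2 := fun A i =>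
    Finset.sum_nonneg fun a _ => sq_nonneg _
  have hdetT : T.det = 1 := by
    rw [Matrix.det_of_isUpperTriangular (M := T) (fun i j h => htri i j h)]
    simp [hdiag]
  have hdetO : O.det ^ 2 = 1 := by
    have := congrArg Matrix.det hO
    rw [Matrix.det_mul, Matrix.det_transpose, Matrix.det_one] at this
    rw [sq]; exact this
  have hdet := hadamard_aux (T * O)
  rw [Matrix.det_mul, hdetT, one_mul, hdetO, ← Finset.prod_mul_prod_compl Z] at hdet
  have hA : ∏ i ∈ Z, ∑ a, (T * O) a i ^ 2 ≤ Real.exp (m / 4 - Z.card) := by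
    calc ∏ i ∈ Z, ∑ a, (T * O) a i ^ 2 
        ≤ ∏ i ∈ Z, Real.exp ((∑ a, ((T - M) * O) a i ^ 2) - 1) := by
          refine Finset.prod_le_prod (fun i _ => hnn _ i) fun i hi => ?_
          rw [hcol i hi]
          have := Real.add_one_le_exp ((∑ a, ((T - M) * O) a i ^ 2) - 1)
          linarith
      _ = Real.exp (∑ i ∈ Z, ((∑ a, ((T - M) * O) a i ^ 2) - 1)) := (Real.exp_sum _ _).symm
      _ ≤ _ := by
          apply Real.exp_le_exp.2
          rw [Finset.sum_sub_distrib]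
          have h1 : ∑ i ∈ Z, ∑ a, ((T - M) * O) a i ^ 2 ≤ ∑ i, ∑ a, ((T - M) * O) a i ^ 2 :=
            Finset.sum_le_sum_of_subset_of_nonneg (Finset.subset_univ _) fun i _ _ => hnn _ i
          rw [sumsq_orth _ _ hO] at h1
          simp
          linarith
  have hB : ∏ i ∈ Zᶜ, ∑ a, (T * O) a i ^ 2 ≤ Real.exp (r * (2 * Real.log m)) := by
    calc ∏ i ∈ Zᶜ, ∑ a, (T * O) a i ^ 2 ≤ ∏ i ∈ Zᶜ, (m : ℝ) ^ 2 := by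
          refine Finset.prod_le_prod (fun i _ => hnn _ i) fun i hi => ?_
          have h1 := Finset.single_le_sum (f := fun i => ∑ a, (T * O) a i ^ 2)
            (fun i _ => hnn _ i) (Finset.mem_univ i)
          rw [sumsq_orth _ _ hO] at h1
          exact h1.trans hT
      _ = ((m : ℝ) ^ 2) ^ (Zᶜ).card := by simp
      _ ≤ ((m : ℝ) ^ 2) ^ r := pow_le_pow_right₀ (one_le_pow₀ hmpos) hZc
      _ = _ := by
          rw [Real.exp_nat_mul, mul_comm, Real.exp_mul, Real.exp_log (by linarith)]
          norm_num
  have h1 : (1 : ℝ) ≤ Real.exp (m / 4 - Z.card + r * (2 * Real.log m)) := by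
    rw [Real.exp_add]
    exact hdet.trans (mul_le_mul hA hB (Finset.prod_nonneg fun i _ => hnn _ i) (Real.exp_pos _).le)
  have h2 : 0 ≤ (m : ℝ) / 4 - Z.card + r * (2 * Real.log m) := by
    rw [← Real.exp_zero] at h1
    exact Real.exp_le_exp.1 h1
  have h3 : ((Zᶜ).card : ℝ) ≤ r := by exact_mod_cast hZc
  linarith
/-- Bilinear form of a matrix. -/
def bil {d : ℕ} (X : Matrix (Fin d) (Fin d) ℝ) (v w : Fin d → ℝ) : ℝ := v ⬝ᵥ (X *ᵥ w)

/-- The projections of rank `d - k + 1`. -/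
def KS (d k : ℕ) : Set (Matrix (Fin d) (Fin d) ℝ) :=
  {P | P.IsHermitian ∧ P * P = P ∧ P.rank = d - k + 1}

lemma bil_add {d : ℕ} (X Y : Matrix (Fin d) (Fin d) ℝ) (v w : Fin d → ℝ) :
    bil (X + Y) v w = bil X v w + bil Y v w := by
  simp [bil, Matrix.add_mulVec, dotProduct_add]

lemma bil_smul {d : ℕ} (a : ℝ) (X : Matrix (Fin d) (Fin d) ℝ) (v w : Fin d → ℝ) :
    bil (a • X) v w = a * bil X v w := by
  simp [bil, Matrix.smul_mulVec, dotProduct_smul]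

lemma frob_outer {d : ℕ} (v : Fin d → ℝ) (P : Matrix (Fin d) (Fin d) ℝ) :
    frob (outer v) P = bil P v v := by
  simp only [frob, outer, bil, Matrix.vecMulVec_apply, dotProduct, Matrix.mulVec, Finset.mul_sum]
  refine Finset.sum_congr rfl fun i _ => Finset.sum_congr rfl fun j _ => by ring

lemma frob_comb {d : ℕ} (α : ℝ) (U : Finset (Fin d → ℝ)) (μ : (Fin d → ℝ) → ℝ)
    (P : Matrix (Fin d) (Fin d) ℝ) :
    frob (α • ∑ u ∈ U, μ u • outer u) P = α * ∑ u ∈ U, μ u * bil P u u := by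
  have h : ∀ u, bil P u u = ∑ i, ∑ j, outer u i j * P i j := fun u => (frob_outer u P).symm
  simp only [frob, h, Matrix.smul_apply, Matrix.sum_apply, smul_eq_mul, Finset.mul_sum,
    Finset.sum_mul]
  rw [Finset.sum_comm' (s := U) (t := fun _ => univ) (t' := univ) (s' := fun _ => U) (by simp)]
  refine Finset.sum_congr rfl fun i _ => ?_
  rw [Finset.sum_comm]
  refine Finset.sum_congr rfl fun j _ => Finset.sum_congr rfl fun j _ => by ring

lemma bil_proj {d k : ℕ} {P : Matrix (Fin d) (Fin d) ℝ} (hP : P ∈ KS d k) (w : Fin d → ℝ) :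
    bil P w w = (P *ᵥ w) ⬝ᵥ (P *ᵥ w) := by
  obtain ⟨h1, h2, -⟩ := hP
  have ht : Pᵀ = P := by
    have := h1.eq
    rwa [Matrix.conjTranspose_eq_transpose_of_trivial] at this
  conv_rhs => rw [Matrix.dotProduct_mulVec, ← Matrix.mulVec_transpose, ht, Matrix.mulVec_mulVec, h2,
    dotProduct_comm]
  rfl

lemma hull_props {d k : ℕ} {X : Matrix (Fin d) (Fin d) ℝ} (hX : X ∈ convexHull ℝ (KS d k)) :
    Xᵀ = X ∧ ∀ w, 0 ≤ bil X w w ∧ bil X w w ≤ w ⬝ᵥ w := by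
  have : convexHull ℝ (KS d k) ⊆ {X | Xᵀ = X ∧ ∀ w, 0 ≤ bil X w w ∧ bil X w w ≤ w ⬝ᵥ w} := by
    apply convexHull_min
    · intro P hP
      refine ⟨?_, fun w => ?_⟩
      · have := hP.1.eq
        rwa [Matrix.conjTranspose_eq_transpose_of_trivial] at this
      · have h0 := bil_proj hP w
        have h1 : ∀ z : Fin d → ℝ, 0 ≤ z ⬝ᵥ z := fun z =>
          Finset.sum_nonneg fun i _ => mul_self_nonneg _
        refine ⟨h0 ▸ h1 _, ?_⟩
        have h2 := h1 (w - P *ᵥ w)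
        simp only [sub_dotProduct, dotProduct_sub] at h2
        rw [dotProduct_comm (P *ᵥ w) w] at h2
        rw [← h0] at h2
        change 0 ≤ w ⬝ᵥ w - bil P w w - (bil P w w - bil P w w) at h2
        linarith
    · rintro X ⟨hX1, hX2⟩ Y ⟨hY1, hY2⟩ a b ha hb hab
      refine ⟨by simp [hX1, hY1], fun w => ?_⟩
      rw [bil_add, bil_smul, bil_smul]
      obtain ⟨x1, x2⟩ := hX2 w
      obtain ⟨y1, y2⟩ := hY2 w
      refine ⟨by positivity, ?_⟩
      calc a * bil X w w + b * bil Y w w ≤ a * (w ⬝ᵥ w) + b * (w ⬝ᵥ w) := by gcongr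
        _ = w ⬝ᵥ w := by rw [← add_mul, hab, one_mul]
  exact this hX

lemma bil_cs {d : ℕ} {X : Matrix (Fin d) (Fin d) ℝ} (hs : Xᵀ = X) (hp : ∀ w, 0 ≤ bil X w w)
    (v w : Fin d → ℝ) : bil X v w ^ 2 ≤ bil X v v * bil X w w := by
  have hsym : bil X w v = bil X v w := by
    unfold bil
    rw [Matrix.dotProduct_mulVec, ← Matrix.mulVec_transpose, hs, dotProduct_comm]
  have h : ∀ x : ℝ, 0 ≤ bil X w w * (x * x) + (2 * bil X v w) * x + bil X v v := by
    intro x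
    have h1 := hp (v + x • w)
    have h2 : bil X (v + x • w) (v + x • w) =
        bil X v v + x * bil X v w + x * (bil X w v + x * bil X w w) := by
      simp [bil, Matrix.mulVec_add, Matrix.mulVec_smul]
      ring
    rw [h2, hsym] at h1
    linarith
  have := discrim_le_zero h
  rw [discrim] at this
  nlinarith

lemma exists_proj {d k m : ℕ} {X : Matrix (Fin d) (Fin d) ℝ} (hX : X ∈ convexHull ℝ (KS d k))
    (v : Fin m → Fin d → ℝ) :
    ∃ Q ∈ KS d k, ∑ j, bil Q (v j) (v j) ≤ ∑ j, bil X (v j) (v j) := by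
  by_contra! hcon
  have : convexHull ℝ (KS d k) ⊆ {Y | ∑ j, bil X (v j) (v j) < ∑ j, bil Y (v j) (v j)} := by
    apply convexHull_min
    · intro Q hQ
      exact hcon Q hQ
    · rw [convex_iff_forall_pos]
      intro Y hY Z hZ a b ha hb hab
      simp only [Set.mem_ofPred_eq, bil_add, bil_smul, Finset.sum_add_distrib,
        ← Finset.mul_sum] at *
      calc ∑ j, bil X (v j) (v j) = a * ∑ j, bil X (v j) (v j) + b * ∑ j, bil X (v j) (v j) := by
            rw [← add_mul, hab, one_mul]
        _ < _ := by gcongr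
  have h := this hX
  rw [Set.mem_ofPred_eq] at h
  exact lt_irrefl _ h

lemma duality {d k : ℕ} {α : ℝ} (U : Finset (Fin d → ℝ)) (hU : U.Nonempty) (v : Fin d → ℝ)
    (hno : ¬ ∃ X ∈ convexHull ℝ (KS d k), ∀ u ∈ U, α * bil X u u < bil X v v) :
    ∃ μ : (Fin d → ℝ) → ℝ, (∀ u, 0 ≤ μ u) ∧ (∑ u ∈ U, μ u) = 1 ∧
      PrecK k (outer v) (α • ∑ u ∈ U, μ u • outer u) := by
  classical
  by_cases hK : (KS d k).Nonempty
  swap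
  · obtain ⟨u0, hu0⟩ := hU
    refine ⟨fun u => if u = u0 then 1 else 0, fun u => by dsimp only; split_ifs <;> simp,
      by simp [hu0], fun P h1 h2 h3 => (hK ⟨P, h1, h2, h3⟩).elim⟩
  obtain ⟨P0, hP0⟩ := hK
  let s : Set (U → ℝ) := {y | ∀ u, y u < 0}
  let t : Set (U → ℝ) := {y | ∃ X ∈ convexHull ℝ (KS d k), ∀ u : U,
    y u = α * bil X u u - bil X v v}
  have hs1 : Convex ℝ s := by
    rw [convex_iff_forall_pos]
    intro x hx y hy a b ha hb hab u
    have h1 := mul_neg_of_pos_of_neg ha (hx u)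
    have h2 := mul_neg_of_pos_of_neg hb (hy u)
    simp only [Pi.add_apply, Pi.smul_apply, smul_eq_mul]
    linarith
  have hs2 : IsOpen s := by
    have : s = ⋂ u, {y : U → ℝ | y u < 0} := by ext y; simp [s]
    rw [this]
    exact isOpen_iInter_of_finite fun u => isOpen_lt (continuous_apply u) continuous_const
  have ht : Convex ℝ t := by
    rintro x ⟨X, hX, hx⟩ y ⟨Y, hY, hy⟩ a b ha hb hab
    refine ⟨a • X + b • Y, convex_convexHull ℝ _ hX hY ha hb hab, fun u => ?_⟩
    simp only [Pi.add_apply, Pi.smul_apply, smul_eq_mul, hx, hy, bil_add, bil_smul]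
    ring
  have hdisj : Disjoint s t := by
    rw [Set.disjoint_left]
    rintro y hy ⟨X, hX, hyX⟩
    refine hno ⟨X, hX, fun u hu => ?_⟩
    have h1 := hy ⟨u, hu⟩
    have h2 := hyX ⟨u, hu⟩
    simp only at h2
    linarith
  obtain ⟨f, c, hfs, hft⟩ := geometric_hahn_banach_open hs1 hs2 ht hdisj
  let g : U → ℝ := fun u => f (Pi.single u 1)
  have hf : ∀ y, f y = ∑ u, y u * g u := by
    intro y
    conv_lhs => rw [pi_eq_sum_univ' y, map_sum]
    refine Finset.sum_congr rfl fun u _ => ?_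
    rw [map_smul, smul_eq_mul]
  let G := ∑ u, g u
  have hfe : ∀ ε > 0, - ε * G < c := by
    intro ε hε
    have h1 := hfs (fun _ => -ε) (fun _ => by linarith)
    rw [hf, ← Finset.mul_sum] at h1
    exact h1
  have hg : ∀ u, 0 ≤ g u := by
    intro u
    by_contra! hneg
    have h1 : ∀ a ≥ 0, - G - a * g u < c := by
      intro a ha
      have h2 := hfs (fun w => -1 - if w = u then a else 0) (fun w => by
        dsimp only
        split_ifs <;> linarith)
      rw [hf] at h2
      simp only [sub_mul, Finset.sum_sub_distrib, ite_mul, zero_mul, Finset.sum_ite_eq',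
        Finset.mem_univ, if_true, ← Finset.mul_sum] at h2
      linarith
    have h3 := h1 ((|c| + |G| + 1) / (- g u)) (div_nonneg (by positivity) (by linarith))
    have h4 : (|c| + |G| + 1) / (- g u) * g u = -(|c| + |G| + 1) := by
      have := hneg.ne
      field_simp
    rw [h4] at h3
    have := le_abs_self c
    have := le_abs_self G
    linarith
  have hc : 0 ≤ c := by
    by_contra! hc
    have hG : 0 ≤ G := Finset.sum_nonneg fun u _ => hg u
    have h1 := hfe (-c / (G + 1)) (div_pos (by linarith) (by linarith))
    have h2 : - (-c / (G + 1)) * G = c * (G / (G + 1)) := by ring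
    rw [h2] at h1
    have h3 : G / (G + 1) ≤ 1 := by rw [div_le_one (by linarith)]; linarith
    nlinarith
  have hmem : ∀ P ∈ KS d k, c ≤ ∑ u : U, (α * bil P u u - bil P v v) * g u := by
    intro P hP
    have := hft (fun u => α * bil P u u - bil P v v) ⟨P, subset_convexHull ℝ _ hP, fun u => rfl⟩
    rwa [hf] at this
  have hG : 0 < G := by
    rcases (Finset.sum_nonneg fun u _ => hg u : 0 ≤ G).lt_or_eq with h | h
    · exact h
    exfalso
    have h0 : ∀ u, g u = 0 := fun u =>
      (Finset.sum_eq_zero_iff_of_nonneg (fun u _ => hg u)).1 h.symm u (Finset.mem_univ u)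
    have h1 := hmem P0 hP0
    have h2 := hfe 1 one_pos
    simp [h0] at h1
    have h3 : G = 0 := h.symm
    rw [h3] at h2
    linarith
  refine ⟨fun u => if h : u ∈ U then g ⟨u, h⟩ / G else 0, fun u => ?_, ?_, ?_⟩
  · dsimp only
    split_ifs
    · exact div_nonneg (hg _) hG.le
    · exact le_rfl
  · rw [← Finset.sum_coe_sort U]
    simp only [Subtype.coe_eta, Finset.coe_mem, dif_pos, ← Finset.sum_div]
    exact div_self hG.ne'
  · intro P h1 h2 h3
    have h4 := hc.trans (hmem P ⟨h1, h2, h3⟩)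
    rw [frob_outer, frob_comb, ← Finset.sum_coe_sort U]
    simp only [Subtype.coe_eta, Finset.coe_mem, dif_pos]
    have h5 : ∑ u : U, (α * bil P u u - bil P v v) * g u
        = G * (α * ∑ u : U, g u / G * bil P u u) - G * bil P v v := by
      simp only [sub_mul, Finset.sum_sub_distrib, ← Finset.mul_sum]
      have : ∀ u : U, G * (α * (g u / G * bil P u u)) = α * bil P u u * g u := by
        intro u; field_simp
      rw [mul_comm G (bil P v v)]
      congr 1
      rw [Finset.mul_sum, Finset.mul_sum]
      exact Finset.sum_congr rfl fun u _ => (this u).symm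
    rw [h5] at h4
    have h6 : G * bil P v v ≤ G * (α * ∑ u : U, g u / G * bil P u u) := by linarith
    exact le_of_mul_le_mul_left h6 hG

lemma step {d k : ℕ} {α : ℝ} (hα : 0 ≤ α) {V U : Finset (Fin d → ℝ)} (hUV : U ⊆ V)
    (hU : U.Nonempty) (hns : ¬ IsSpectralKSpanner k α V U) :
    ∃ X, ∃ v, X ∈ convexHull ℝ (KS d k) ∧ v ∈ V ∧ 0 < bil X v v ∧
      (∀ u ∈ U, α * bil X u u < bil X v v) ∧ (∀ w ∈ V, bil X w w ≤ bil X v v) ∧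
      ∀ X' ∈ convexHull ℝ (KS d k), ∀ v' ∈ V, (∀ u ∈ U, α * bil X' u u < bil X' v' v') →
        bil X' v' v' ≤ 2 * bil X v v := by
  have h1 : ∃ v ∈ V, ∃ X ∈ convexHull ℝ (KS d k), ∀ u ∈ U, α * bil X u u < bil X v v := by
    by_contra! hcon
    refine hns ⟨hUV, fun v hv => duality U hU v ?_⟩
    rintro ⟨X, hX, h⟩
    obtain ⟨u, hu, h'⟩ := hcon v hv X hX
    exact absurd (h u hu) (not_lt.2 h')
  obtain ⟨v0, hv0, X0, hX0, h0⟩ := h1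
  let S : Set ℝ := {t | ∃ X ∈ convexHull ℝ (KS d k), ∃ v ∈ V, t = bil X v v ∧
    ∀ u ∈ U, α * bil X u u < t}
  have hbdd : BddAbove S := by
    refine ⟨∑ w ∈ V, w ⬝ᵥ w, ?_⟩
    rintro t ⟨X, hX, v, hv, rfl, -⟩
    refine ((hull_props hX).2 v).2.trans ?_
    exact Finset.single_le_sum (f := fun w : Fin d → ℝ => w ⬝ᵥ w)
      (fun w _ => Finset.sum_nonneg fun i _ => mul_self_nonneg _) hv
  have hpos : ∀ t ∈ S, 0 < t := by
    rintro t ⟨X, hX, v, hv, rfl, h⟩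
    obtain ⟨u, hu⟩ := hU
    exact lt_of_le_of_lt (mul_nonneg hα ((hull_props hX).2 u).1) (h u hu)
  have hS0 : bil X0 v0 v0 ∈ S := ⟨X0, hX0, v0, hv0, rfl, h0⟩
  have hsup : 0 < sSup S := (hpos _ hS0).trans_le (le_csSup hbdd hS0)
  obtain ⟨t, ⟨X, hX, v1, hv1, rfl, h⟩, htS⟩ := exists_lt_of_lt_csSup ⟨_, hS0⟩ (half_lt_self hsup)
  obtain ⟨v, hv, hmax⟩ := Finset.exists_max_image V (fun w => bil X w w) ⟨v1, hv1⟩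
  have hle := hmax v1 hv1
  refine ⟨X, v, hX, hv, ?_, fun u hu => (h u hu).trans_le hle, hmax, ?_⟩
  · exact (hpos _ ⟨X, hX, v1, hv1, rfl, h⟩).trans_le hle
  · intro X' hX' v' hv' h'
    have := le_csSup hbdd (⟨X', hX', v', hv', rfl, h'⟩ : bil X' v' v' ∈ S)
    linarith

lemma rank_one_sub {d k : ℕ} (hk : 1 ≤ k) (hkd : k ≤ d) {Q : Matrix (Fin d) (Fin d) ℝ}
    (hQ : Q ∈ KS d k) : (1 - Q).rank ≤ k - 1 := by
  obtain ⟨-, h2, h3⟩ := hQ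
  have h0 : Q * (1 - Q) = 0 := by rw [Matrix.mul_sub, h2, Matrix.mul_one, sub_self]
  have h := Matrix.rank_add_rank_le_card_of_mul_eq_zero h0
  rw [Fintype.card_fin] at h
  omega

lemma core {d k m : ℕ} (hk : 1 ≤ k) (hkd : k ≤ d) (hm : 1 ≤ m) {α : ℝ} (hα : 24 * (m : ℝ) ≤ α)
    (X : ℕ → Matrix (Fin d) (Fin d) ℝ) (v : ℕ → Fin d → ℝ)
    (hX : ∀ i ≤ m, X i ∈ convexHull ℝ (KS d k))
    (hpos : ∀ i ≤ m, 0 < bil (X i) (v i) (v i))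
    (hlow : ∀ i ≤ m, ∀ j < i, α * bil (X i) (v j) (v j) ≤ bil (X i) (v i) (v i))
    (hmax : ∀ i ≤ m, ∀ j ≤ m, bil (X i) (v j) (v j) ≤ bil (X i) (v i) (v i))
    (hmono : ∀ i ≤ m, bil (X m) (v m) (v m) ≤ 2 * bil (X i) (v i) (v i)) :
    (3 / 4 : ℝ) * m ≤ ((k - 1 : ℕ) : ℝ) * (1 + 2 * Real.log m) := by
  have hmpos : (1 : ℝ) ≤ m := by exact_mod_cast hm
  have hα0 : 0 < α := by linarith
  let t : ℕ → ℝ := fun i => bil (X i) (v i) (v i)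
  obtain ⟨Q, hQ, hQs⟩ := exists_proj (hX m le_rfl) (fun j : Fin m => v j)
  have hQsum : ∑ j : Fin m, bil Q (v j) (v j) ≤ m * (t m / α) := by
    refine hQs.trans ?_
    calc ∑ j : Fin m, bil (X m) (v j) (v j) ≤ ∑ j : Fin m, t m / α := by
          refine Finset.sum_le_sum fun j _ => ?_
          rw [le_div_iff₀ hα0, mul_comm]
          exact hlow m le_rfl j j.2
      _ = _ := by simp
  let A : Matrix (Fin m) (Fin d) ℝ := Matrix.of fun i => (t i)⁻¹ • (v i ᵥ* X i)
  let B : Matrix (Fin d) (Fin m) ℝ := Matrix.of fun a j => v j a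
  have hentry : ∀ (Y : Matrix (Fin d) (Fin d) ℝ) (i j : Fin m),
      (A * Y * B) i j = (t i)⁻¹ * bil (X i) (v i) (Y *ᵥ v j) := by
    intro Y i j
    have : (A * Y * B) i j = A i ⬝ᵥ (Y *ᵥ v j) := by
      rw [Matrix.mul_assoc, Matrix.mul_apply]
      rfl
    rw [this]
    change ((t i)⁻¹ • (v i ᵥ* X i)) ⬝ᵥ (Y *ᵥ v j) = _
    rw [smul_dotProduct, smul_eq_mul, bil, Matrix.dotProduct_mulVec (v i)]
  let T : Matrix (Fin m) (Fin m) ℝ := Matrix.of fun i j =>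
    if j < i then 0 else (t i)⁻¹ * bil (X i) (v i) (v j)
  have htp : ∀ i : Fin m, 0 < t i := fun i => hpos i i.2.le
  have hcs : ∀ (i : Fin m) (w : Fin d → ℝ),
      ((t i)⁻¹ * bil (X i) (v i) w) ^ 2 ≤ (t i)⁻¹ * bil (X i) w w := by
    intro i w
    have hp := hull_props (hX i i.2.le)
    have h1 := bil_cs hp.1 (fun w => (hp.2 w).1) (v i) w
    have h2 := htp i
    calc ((t i)⁻¹ * bil (X i) (v i) w) ^ 2 = ((t i)⁻¹) ^ 2 * bil (X i) (v i) w ^ 2 := by ring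
      _ ≤ ((t i)⁻¹) ^ 2 * (t i * bil (X i) w w) := by gcongr
      _ = _ := by field_simp
  let R : Matrix (Fin m) (Fin m) ℝ := A * (1 - Q) * B
  have hR : ∀ i j : Fin m, R i j = (t i)⁻¹ * bil (X i) (v i) ((1 - Q) *ᵥ v j) :=
    hentry (1 - Q)
  refine rank_lemma (r := k - 1) hm T R ?_ ?_ ?_ ?_ ?_
  · intro i j hij
    simp [T, hij]
  · intro i
    have := htp i
    simp only [T, Matrix.of_apply, lt_irrefl, if_false]
    exact inv_mul_cancel₀ this.ne'
  · intro i j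
    simp only [T, Matrix.of_apply]
    split_ifs
    · norm_num
    · refine (hcs i (v j)).trans ?_
      rw [inv_mul_le_iff₀ (htp i), mul_one]
      exact hmax i i.2.le j j.2.le
  · refine (Matrix.rank_mul_le_left _ _).trans ((Matrix.rank_mul_le_right _ _).trans ?_)
    exact rank_one_sub hk hkd hQ
  · have hbound : ∀ i j : Fin m, (T - R) i j ^ 2 ≤
        2 / α + 2 * ((t i)⁻¹ * bil Q (v j) (v j)) := by
      intro i j
      have hD : ((t i)⁻¹ * bil (X i) (v i) (Q *ᵥ v j)) ^ 2 ≤ (t i)⁻¹ * bil Q (v j) (v j) := by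
        refine (hcs i _).trans ?_
        have := htp i
        gcongr
        rw [bil_proj hQ]
        exact ((hull_props (hX i i.2.le)).2 _).2
      have hsub : bil (X i) (v i) ((1 - Q) *ᵥ v j) =
          bil (X i) (v i) (v j) - bil (X i) (v i) (Q *ᵥ v j) := by
        simp [bil, Matrix.sub_mulVec, Matrix.mulVec_sub, dotProduct_sub]
      have hα2 : 0 < 2 / α := by positivity
      rw [Matrix.sub_apply, hR, hsub]
      simp only [T, Matrix.of_apply]
      set a := (t i)⁻¹ * bil (X i) (v i) (Q *ᵥ v j) with ha
      rw [mul_sub, ← ha]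
      split_ifs with hij
      · have hL : ((t i)⁻¹ * bil (X i) (v i) (v j)) ^ 2 ≤ 1 / α := by
          refine (hcs i _).trans ?_
          rw [inv_mul_le_iff₀ (htp i), mul_one_div, le_div_iff₀ hα0, mul_comm]
          exact hlow i i.2.le j hij
        have h22 : 2 / α = 2 * (1 / α) := by ring
        rw [h22]
        nlinarith [sq_nonneg ((t i)⁻¹ * bil (X i) (v i) (v j) + a)]
      · have : (0 : ℝ) ≤ a ^ 2 := sq_nonneg a
        ring_nf at *
        linarith
    have hrow : ∀ i : Fin m, ∑ j : Fin m, (t i)⁻¹ * bil Q (v j) (v j) ≤ m * (2 / α) := by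
      intro i
      rw [← Finset.mul_sum, inv_mul_le_iff₀ (htp i)]
      refine hQsum.trans ?_
      have h1 : t m ≤ 2 * t i := hmono i i.2.le
      calc (m : ℝ) * (t m / α) ≤ m * (2 * t i / α) := by gcongr
        _ = _ := by ring
    calc ∑ i, ∑ a, (T - R) a i ^ 2
        = ∑ a, ∑ i, (T - R) a i ^ 2 := Finset.sum_comm
      _ ≤ ∑ a : Fin m, ∑ i : Fin m, (2 / α + 2 * ((t a)⁻¹ * bil Q (v i) (v i))) :=
          Finset.sum_le_sum fun a _ => Finset.sum_le_sum fun i _ => hbound a i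
      _ ≤ ∑ a : Fin m, (m * (2 / α) + 2 * (m * (2 / α))) := by
          refine Finset.sum_le_sum fun a _ => ?_
          rw [Finset.sum_add_distrib, ← Finset.mul_sum]
          have := hrow a
          simp only [Finset.sum_const, Finset.card_univ, Fintype.card_fin, nsmul_eq_mul]
          linarith
      _ = (m * 6) * m / α := by simp; ring
      _ ≤ m / 4 := by
          rw [div_le_iff₀ hα0]
          nlinarith

lemma greedy {d k m : ℕ} (hk : 1 ≤ k) (hkd : k ≤ d) (hm : 1 ≤ m) {α : ℝ} (hα : 24 * (m : ℝ) ≤ α)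
    (hnum : ((k - 1 : ℕ) : ℝ) * (1 + 2 * Real.log m) < (3 / 4 : ℝ) * m)
    (V : Finset (Fin d → ℝ)) (hV : V.Nonempty) :
    ∃ U : Finset (Fin d → ℝ), U.card ≤ m + 1 ∧ IsSpectralKSpanner k α V U := by
  classical
  by_contra! hcon
  have hmpos : (1 : ℝ) ≤ m := by exact_mod_cast hm
  have hα0 : 0 ≤ α := by linarith
  obtain ⟨v0, hv0⟩ := hV
  have hst := fun (U : Finset (Fin d → ℝ)) (h1 : U ⊆ V) (h2 : U.Nonempty) (h3 : U.card ≤ m + 1) =>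
    step hα0 h1 h2 (hcon U h3)
  choose! X v h using hst
  let Us : ℕ → Finset (Fin d → ℝ) := fun i => Nat.rec {v0} (fun _ U => insert (v U) U) i
  have hsucc : ∀ i, Us (i + 1) = insert (v (Us i)) (Us i) := fun i => rfl
  have hUs : ∀ i ≤ m, Us i ⊆ V ∧ (Us i).Nonempty ∧ (Us i).card ≤ i + 1 := by
    intro i
    induction i with
    | zero => intro _; simp [Us, hv0]
    | succ n ih =>
      intro hn
      obtain ⟨h1, h2, h3⟩ := ih (by omega)
      rw [hsucc]
      refine ⟨Finset.insert_subset ((h _ h1 h2 (by omega)).2.1) h1, Finset.insert_nonempty _ _, ?_⟩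
      exact (Finset.card_insert_le _ _).trans (by omega)
  have hmonoU : Monotone Us := monotone_nat_of_le_succ fun i => by
    rw [hsucc]; exact Finset.subset_insert _ _
  have hP := fun i (hi : i ≤ m) => h (Us i) (hUs i hi).1 (hUs i hi).2.1
    ((hUs i hi).2.2.trans (by omega))
  have hmem : ∀ i, ∀ j < i, v (Us j) ∈ Us i := fun i j hj =>
    hmonoU (Nat.succ_le_of_lt hj) (by rw [Nat.succ_eq_add_one, hsucc]; exact Finset.mem_insert_self _ _)
  have := core hk hkd hm hα (fun i => X (Us i)) (fun i => v (Us i))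
    (fun i hi => (hP i hi).1) (fun i hi => (hP i hi).2.2.1)
    (fun i hi j hj => ((hP i hi).2.2.2.1 _ (hmem i j hj)).le)
    (fun i hi j hj => (hP i hi).2.2.2.2.1 _ (hP j hj).2.1)
    (fun i hi => (hP i hi).2.2.2.2.2 _ (hP m le_rfl).1 _ (hP m le_rfl).2.1
      (fun u hu => (hP m le_rfl).2.2.2.1 u (hmonoU hi hu)))
  linarith

theorem spectral_k_spanner_exists :
    ∃ C > (0:ℝ), ∃ C' > (0:ℝ), ∀ d k : ℕ, 2 ≤ k → k ≤ d →
      ∀ V : Finset (Fin d → ℝ), ∃ U : Finset (Fin d → ℝ),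
        (U.card : ℝ) ≤ C * k * (Real.log k) ^ 2 ∧
        IsSpectralKSpanner k (C' * k * (Real.log k) ^ 3) V U := by
  refine ⟨200, by norm_num, 10000, by norm_num, fun d k hk hkd V => ?_⟩
  rcases V.eq_empty_or_nonempty with rfl | hV
  · exact ⟨∅, by simp; positivity, by simp [IsSpectralKSpanner]⟩
  have hk2 : (2 : ℝ) ≤ k := by exact_mod_cast hk
  set L := Real.log k with hL
  have hL2 : Real.log 2 ≤ L := Real.log_le_log (by norm_num) hk2
  have hl2 := Real.log_two_gt_d9
  have hLhalf : 1 / 2 ≤ L := by linarith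
  have hLk : L ≤ k - 1 := Real.log_le_sub_one_of_pos (by linarith)
  let m := ⌈64 * (k : ℝ) * L⌉₊
  have hm1 : 64 * (k : ℝ) * L ≤ m := Nat.le_ceil _
  have hm2 : (m : ℝ) < 64 * (k : ℝ) * L + 1 := Nat.ceil_lt_add_one (by positivity)
  have hkL : (1 : ℝ) ≤ k * L := by nlinarith
  have hm : 1 ≤ m := by
    have : (1 : ℝ) ≤ m := by nlinarith
    exact_mod_cast this
  have hmp : (0 : ℝ) < m := by exact_mod_cast hm
  have hlogm : Real.log m ≤ 6 * Real.log 2 + 2 * L := by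
    have h1 : (m : ℝ) ≤ 2 ^ 6 * (k : ℝ) ^ 2 := by nlinarith
    have h2 := Real.log_le_log hmp h1
    rw [Real.log_mul (by norm_num) (by positivity), Real.log_pow, Real.log_pow] at h2
    push_cast at h2
    exact h2
  have hk1 : ((k - 1 : ℕ) : ℝ) = k - 1 := by
    rw [Nat.cast_sub (by omega)]; simp
  have hkL2 : (k : ℝ) * L ≤ 2 * (k * L ^ 2) := by nlinarith
  have hkL3 : (k : ℝ) * L ^ 2 ≤ 2 * (k * L ^ 3) := by
    have : 0 ≤ (k : ℝ) * L ^ 2 := by positivity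
    nlinarith
  obtain ⟨U, hU1, hU2⟩ := greedy (k := k) (m := m) (α := 10000 * k * L ^ 3) (by omega) hkd hm
    (by nlinarith) (by
      rw [hk1]
      have h1 : 1 + 2 * Real.log m ≤ 18 * L := by linarith
      have h2 : ((k : ℝ) - 1) * (1 + 2 * Real.log m) ≤ (k - 1) * (18 * L) := by
        apply mul_le_mul_of_nonneg_left h1; linarith
      nlinarith) V hV
  refine ⟨U, ?_, hU2⟩
  have h1 : (U.card : ℝ) ≤ m + 1 := by exact_mod_cast hU1
  nlinarith
end
end

section
/- There is a universal constant C > 0 such that the following holds. Let 0 < ε < 1/2 and let M ∈ ℝ^{m×m} be a matrix with M_{i,i} > 0 for all i, satisfying |M_{j,i}| ≤ ε·M_{i,i} for all 1 ≤ j < i ≤ m (approximately lower triangular) and |M_{j,i}| ≤ M_{i,i} for all 1 ≤ i < j ≤ m (diagonally dominant columns). Then rank(M) ≥ C · min{ (1/(ε·log(1/ε)))², m/log m }. -/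
open Matrix Finset

theorem aux_step {d : ℕ} (A : Matrix (Fin d) (Fin d) ℝ) (hA : A.PosDef) (u v : Fin d → ℝ)
    (huv : u ⬝ᵥ v = 1) (hv : v ⬝ᵥ (A *ᵥ v) ≤ 2) :
    3 / 2 * A.det ≤ (A + vecMulVec u u).det := by
  have hdet : 0 < A.det := hA.det_pos
  have hu : IsUnit A.det := hdet.ne'.isUnit
  set w := A⁻¹ *ᵥ u with hw
  have hAw : A *ᵥ w = u := by
    rw [hw, mulVec_mulVec, mul_nonsing_inv _ hu, one_mulVec]
  have hAT : Aᵀ = A := by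
    have := hA.1
    rwa [IsHermitian, conjTranspose_eq_transpose_of_trivial] at this
  have h1 : A + vecMulVec u u = A * (1 + replicateCol Unit w * replicateRow Unit u) := by
    rw [Matrix.mul_add, Matrix.mul_one, ← vecMulVec_eq, mul_vecMulVec, hAw]
  rw [h1, det_mul, det_one_add_replicateCol_mul_replicateRow]
  have hsym : w ⬝ᵥ (A *ᵥ v) = 1 := by
    rw [dotProduct_mulVec, ← mulVec_transpose, hAT, hAw, huv]
  have hs : 0 ≤ (v - (2:ℝ) • w) ⬝ᵥ (A *ᵥ (v - (2:ℝ) • w)) := by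
    simpa using hA.posSemidef.dotProduct_mulVec_nonneg (v - (2:ℝ) • w)
  rw [mulVec_sub, mulVec_smul, hAw] at hs
  simp only [sub_dotProduct, dotProduct_sub, smul_dotProduct, dotProduct_smul, smul_eq_mul, hsym]
    at hs
  rw [dotProduct_comm v u, dotProduct_comm w u, huv] at hs
  nlinarith

def auxS {n d : ℕ} (u : Fin n → Fin d → ℝ) (k : ℕ) : Matrix (Fin d) (Fin d) ℝ :=
  ∑ j ∈ univ.filter (fun j : Fin n => (j:ℕ) < k), vecMulVec (u j) (u j)

theorem auxS_quad {n d : ℕ} (u : Fin n → Fin d → ℝ) (k : ℕ) (v : Fin d → ℝ) :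
    v ⬝ᵥ (auxS u k *ᵥ v) = ∑ j ∈ univ.filter (fun j : Fin n => (j:ℕ) < k), (u j ⬝ᵥ v) ^ 2 := by
  rw [auxS, Matrix.sum_mulVec, dotProduct_sum]
  refine Finset.sum_congr rfl fun j _ => ?_
  rw [vecMulVec_mulVec]
  simp [dotProduct_comm v, sq]

theorem auxS_herm {n d : ℕ} (u : Fin n → Fin d → ℝ) (k : ℕ) : (auxS u k).PosSemidef := by
  unfold auxS
  refine Matrix.posSemidef_sum _ fun j _ => ?_
  simpa using posSemidef_vecMulVec_self_star (u j)

theorem auxS_succ {n d : ℕ} (u : Fin n → Fin d → ℝ) (k : ℕ) (hk : k < n) :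
    auxS u (k+1) = auxS u k + vecMulVec (u ⟨k, hk⟩) (u ⟨k, hk⟩) := by
  unfold auxS
  have : univ.filter (fun j : Fin n => (j:ℕ) < k + 1)
      = insert ⟨k, hk⟩ (univ.filter (fun j : Fin n => (j:ℕ) < k)) := by
    ext j
    simp [Fin.ext_iff]
    omega
  rw [this, Finset.sum_insert (by simp), add_comm]

theorem aux_core {n d : ℕ} (hn : 0 < n) (u v : Fin n → Fin d → ℝ) (ε : ℝ)
    (hε : n * ε ^ 2 ≤ 1)
    (hinj : ∀ x : Fin d → ℝ, (∀ j, u j ⬝ᵥ x = 0) → x = 0)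
    (h1 : ∀ i, u i ⬝ᵥ v i = 1)
    (h2 : ∀ i j, j < i → |u j ⬝ᵥ v i| ≤ ε)
    (h3 : ∀ i j, |u j ⬝ᵥ v i| ≤ 1) :
    (3 / 2 : ℝ) ^ n ≤ (1 + n) ^ d := by
  have hn' : (0:ℝ) < n := by exact_mod_cast hn
  set A0 : Matrix (Fin d) (Fin d) ℝ := (1 / (n:ℝ)) • auxS u n with hA0
  have hpos : A0.PosDef := by
    refine Matrix.PosDef.smul ?_ (by positivity)
    refine .of_dotProduct_mulVec_pos (auxS_herm u n).1 fun x hx => ?_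
    rw [star_trivial, auxS_quad]
    by_contra hcon
    apply hx
    have h0 := le_antisymm (not_lt.mp hcon) (Finset.sum_nonneg fun j _ => sq_nonneg _)
    rw [Finset.sum_eq_zero_iff_of_nonneg (fun j _ => sq_nonneg _)] at h0
    exact hinj x fun j => by simpa using h0 j (by simp)
  have hq0 : ∀ i, v i ⬝ᵥ (A0 *ᵥ v i) ≤ 1 := by
    intro i
    rw [hA0, smul_mulVec, dotProduct_smul, auxS_quad, smul_eq_mul]
    have : ∑ j ∈ univ.filter (fun j : Fin n => (j:ℕ) < n), (u j ⬝ᵥ v i) ^ 2 ≤ n := by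
      calc _ ≤ ∑ j ∈ univ.filter (fun j : Fin n => (j:ℕ) < n), (1:ℝ) :=
            Finset.sum_le_sum fun j _ => (sq_le_one_iff_abs_le_one _).2 (h3 i j)
        _ = n := by simp
    rw [one_div, inv_mul_le_iff₀ hn']
    simpa using this
  have hind : ∀ k, k ≤ n → (3 / 2 : ℝ) ^ k * A0.det ≤ (A0 + auxS u k).det := by
    intro k
    induction k with
    | zero => intro _; simp [auxS]
    | succ k ih =>
      intro hk
      have hk' : k < n := hk
      have ih' := ih hk'.le
      rw [auxS_succ u k hk', ← add_assoc]
      refine le_trans ?_ (aux_step _ (hpos.add_posSemidef (auxS_herm u k)) _ (v ⟨k, hk'⟩)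
        (h1 _) ?_)
      · rw [pow_succ]; linarith
      · rw [add_mulVec, dotProduct_add, auxS_quad]
        have : ∑ j ∈ univ.filter (fun j : Fin n => (j:ℕ) < k), (u j ⬝ᵥ v ⟨k, hk'⟩) ^ 2 ≤ 1 := by
          calc _ ≤ ∑ j ∈ univ.filter (fun j : Fin n => (j:ℕ) < k), ε ^ 2 := by
                refine Finset.sum_le_sum fun j hj => ?_
                rw [← sq_abs]
                exact pow_le_pow_left₀ (abs_nonneg _) (h2 _ _ (by simpa [Fin.lt_def] using hj)) 2
            _ ≤ ∑ j : Fin n, ε ^ 2 := 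
                Finset.sum_le_sum_of_subset_of_nonneg (by simp) (fun _ _ _ => sq_nonneg _)
            _ = n * ε ^ 2 := by simp
            _ ≤ 1 := hε
        linarith [hq0 ⟨k, hk'⟩]
  have hfin := hind n le_rfl
  have hS : A0 + auxS u n = (1 + (n:ℝ)) • A0 := by
    rw [add_smul, one_smul]
    congr 1
    rw [hA0, smul_smul, mul_one_div_cancel hn'.ne', one_smul]
  have hds : ((1 + (n:ℝ)) • A0).det = (1 + (n:ℝ)) ^ d * A0.det := by
    rw [det_smul A0, Fintype.card_fin]
  rw [hS, hds] at hfin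
  exact le_of_mul_le_mul_right hfin hpos.det_pos

theorem aux_matrix {n : ℕ} (hn : 0 < n) (M : Matrix (Fin n) (Fin n) ℝ) (ε : ℝ)
    (hε : n * ε ^ 2 ≤ 1) (h1 : ∀ i, 0 < M i i)
    (h2 : ∀ i j : Fin n, j < i → |M j i| ≤ ε * M i i)
    (h3 : ∀ i j : Fin n, |M j i| ≤ M i i) :
    (3 / 2 : ℝ) ^ n ≤ (1 + n) ^ M.rank := by
  let W := LinearMap.range M.mulVecLin
  let b : Module.Basis (Fin M.rank) ℝ W := Module.finBasisOfFinrankEq ℝ W rfl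
  have hc : ∀ i, M.col i ∈ W := fun i => ⟨Pi.single i 1, by simp⟩
  let c : Fin n → Fin M.rank → ℝ := fun i => b.repr ⟨M.col i, hc i⟩
  let u : Fin n → Fin M.rank → ℝ := fun j k => (b k).1 j
  have hux : ∀ (x : Fin M.rank → ℝ) j, u j ⬝ᵥ x = (∑ k, x k • b k : W).1 j := by
    intro x j
    simp [u, dotProduct, mul_comm]
  have huc : ∀ i j, u j ⬝ᵥ c i = M j i := by
    intro i j
    rw [hux]
    simp only [c]
    rw [b.sum_repr]
    rfl
  have huv : ∀ i j, u j ⬝ᵥ ((M i i)⁻¹ • c i) = M j i / M i i := by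
    intro i j
    rw [dotProduct_smul, huc, smul_eq_mul]
    ring
  refine aux_core hn u (fun i => (M i i)⁻¹ • c i) ε hε ?_ ?_ ?_ ?_
  · intro x hx
    have h0 : (∑ k, x k • b k : W) = 0 := by
      ext j
      rw [← hux, hx]; rfl
    have := (Fintype.linearIndependent_iff.1 b.linearIndependent) x h0
    exact funext this
  · intro i
    rw [huv, div_self (h1 i).ne']
  · intro i j hij
    rw [huv, abs_div, abs_of_pos (h1 i), div_le_iff₀ (h1 i)]
    exact h2 i j hij
  · intro i j
    rw [huv, abs_div, abs_of_pos (h1 i), div_le_iff₀ (h1 i), one_mul]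
    exact h3 i j

theorem aux_log {n r : ℕ} (hn : 2 ≤ n) (h : (3 / 2 : ℝ) ^ n ≤ (1 + n) ^ r) :
    1 / 6 * (n / Real.log n) ≤ (r : ℝ) := by
  have hn' : (2:ℝ) ≤ n := by exact_mod_cast hn
  have hl : 0 < Real.log n := Real.log_pos (by linarith)
  have h1 := Real.log_le_log (by positivity) h
  rw [Real.log_pow, Real.log_pow] at h1
  have h2 : (1:ℝ) / 3 ≤ Real.log (3 / 2) := by
    have := Real.one_sub_inv_le_log_of_pos (show (0:ℝ) < 3 / 2 by norm_num)
    norm_num at this ⊢; linarith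
  have h3 : Real.log (1 + n) ≤ 2 * Real.log n := by
    rw [show (2:ℝ) * Real.log n = Real.log ((n:ℝ) ^ 2) by rw [Real.log_pow]; norm_num]
    exact Real.log_le_log (by positivity) (by nlinarith)
  rw [← mul_div_assoc, div_le_iff₀ hl]
  have h4 : (r:ℝ) * Real.log (1 + n) ≤ r * (2 * Real.log n) := by gcongr
  have h5 : (n:ℝ) * (1 / 3) ≤ n * Real.log (3 / 2) := by gcongr
  linarith

theorem rank_of_approx_lower_triangular :
    ∃ C > (0:ℝ), ∀ ε : ℝ, 0 < ε → ε < 1/2 →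
      ∀ (m : ℕ) (M : Matrix (Fin m) (Fin m) ℝ),
        (∀ i, 0 < M i i) →
        (∀ i j : Fin m, j < i → |M j i| ≤ ε * M i i) →
        (∀ i j : Fin m, i < j → |M j i| ≤ M i i) →
        C * min ((1 / (ε * Real.log (1/ε))) ^ 2) ((m:ℝ) / Real.log m) ≤ (M.rank : ℝ) := by
  refine ⟨1 / 100, by norm_num, ?_⟩
  intro ε hε0 hε m M h1 h2 h3
  have h3' : ∀ i j : Fin m, |M j i| ≤ M i i := by
    intro i j
    rcases lt_trichotomy i j with h | h | h
    · exact h3 i j h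
    · subst h; rw [abs_of_pos (h1 i)]
    · exact (h2 i j h).trans (by nlinarith [h1 i])
  rcases Nat.lt_or_ge m 2 with hm | hm
  · have : (m:ℝ) / Real.log m = 0 := by interval_cases m <;> simp
    rw [this]
    have h0 := min_le_right ((1 / (ε * Real.log (1/ε))) ^ 2) (0:ℝ)
    have : (0:ℝ) ≤ M.rank := by positivity
    linarith
  have key : ∀ n : ℕ, 2 ≤ n → n ≤ m → n * ε ^ 2 ≤ 1 →
      1 / 6 * (n / Real.log n) ≤ (M.rank : ℝ) := by
    intro n hn hnm hne
    have hr : (M.submatrix (Fin.castLE hnm) (Fin.castLE hnm)).rank ≤ M.rank :=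
      rank_submatrix_le _ _ _
    refine (aux_log hn (aux_matrix (by omega) (M.submatrix (Fin.castLE hnm) (Fin.castLE hnm)) ε
      hne (fun i => h1 _) (fun i j hij => h2 _ _ (Fin.lt_def.2 (Fin.lt_def.1 hij)))
      (fun i j => h3' _ _))).trans ?_
    exact_mod_cast hr
  have hm2 : (2:ℝ) ≤ m := by exact_mod_cast hm
  rcases le_or_gt ((m:ℝ) * ε ^ 2) 1 with hc | hc
  · have hk := key m hm le_rfl hc
    have h0 := min_le_right ((1 / (ε * Real.log (1/ε))) ^ 2) ((m:ℝ) / Real.log m)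
    have hl : 0 < Real.log m := Real.log_pos (by linarith)
    have : 0 ≤ (m:ℝ) / Real.log m := by positivity
    linarith
  · have he2 : 0 < ε ^ 2 := by positivity
    have hX : (4:ℝ) ≤ 1 / ε ^ 2 := by
      rw [le_div_iff₀ he2]; nlinarith
    set n := ⌊1 / ε ^ 2⌋₊ with hn
    have hnle : (n:ℝ) ≤ 1 / ε ^ 2 := Nat.floor_le (by positivity)
    have hnge : 1 / ε ^ 2 < n + 1 := Nat.lt_floor_add_one _
    have hn2 : 2 ≤ n := Nat.le_floor (by push_cast; linarith)
    have hnm : n ≤ m := by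
      have : (n:ℝ) ≤ m := hnle.trans (by rw [div_le_iff₀ he2]; linarith)
      exact_mod_cast this
    have hk := key n hn2 hnm (by rwa [le_div_iff₀ he2] at hnle)
    have h0 := min_le_left ((1 / (ε * Real.log (1/ε))) ^ 2) ((m:ℝ) / Real.log m)
    set L := Real.log (1 / ε) with hL
    have hL2 : 1 / 2 ≤ L := by
      have : Real.log 2 ≤ L := Real.log_le_log (by norm_num) (by
        rw [le_div_iff₀ hε0]; linarith)
      have := Real.log_two_gt_d9
      linarith
    have hn2' : (2:ℝ) ≤ n := by exact_mod_cast hn2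
    have hlp : 0 < Real.log n := Real.log_pos (by linarith)
    have hln : Real.log n ≤ 2 * L := by
      have : Real.log n ≤ Real.log (1 / ε ^ 2) := Real.log_le_log (by linarith) hnle
      rw [show 1 / ε ^ 2 = (1 / ε) ^ 2 by rw [div_pow, one_pow], Real.log_pow] at this
      exact_mod_cast this
    have hA : (1 / ε ^ 2) / 2 / (2 * L) ≤ n / Real.log n := by
      apply div_le_div₀ (by linarith) (by linarith) hlp hln
    have hB : (1 / (ε * L)) ^ 2 ≤ 8 * ((1 / ε ^ 2) / 2 / (2 * L)) := by
      have e1 : (1 / (ε * L)) ^ 2 = (1 / ε ^ 2) / L * (1 / L) := by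
        have : L ≠ 0 := by linarith
        field_simp
      have e2 : 8 * ((1 / ε ^ 2) / 2 / (2 * L)) = (1 / ε ^ 2) / L * 2 := by
        have : L ≠ 0 := by linarith
        field_simp
        norm_num
      rw [e1, e2]
      have : 1 / L ≤ 2 := by rw [div_le_iff₀ (by linarith)]; linarith
      have h6 : 0 ≤ (1 / ε ^ 2) / L := by
        have : 0 < L := by linarith
        positivity
      gcongr
    have hC : 0 ≤ (1 / ε ^ 2) / 2 / (2 * L) := by
      have : 0 < L := by linarith
      positivity
    linarith
end

section
/- There exist universal constants C, C' > 0 such that for all integers 2 ≤ k ≤ d there exists a function c mapping each finite set V ⊆ ℝ^d to a subset c(V) ⊆ V with |c(V)| ≤ C·k·log² k, such that for every finite collection of finite sets V_1, …, V_p ⊆ ℝ^d, max over subsets S ⊆ c(V_1) ∪ … ∪ c(V_p) with |S| = k of det_k( Σ_{v∈S} v vᵀ ) is at least (C'·k²·log³ k)^{−k} times the max over subsets S ⊆ V_1 ∪ … ∪ V_p with |S| = k of det_k( Σ_{v∈S} v vᵀ ). In other words, c is an O(k² log³ k)^k-composable core-set of size O(k log² k) for the k-determinant maximization problem. -/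
/-!
STATEMENT 18: There exist universal constants C, C' > 0 such that for all integers
2 ≤ k ≤ d there exists a function c mapping each finite V ⊆ ℝ^d to a subset
c(V) ⊆ V with |c(V)| ≤ C·k·log² k, such that for every finite collection
V_1, …, V_p ⊆ ℝ^d, the max of det_k( Σ_{v∈S} v vᵀ ) over size-k subsets S of
c(V_1) ∪ … ∪ c(V_p) is at least (C'·k²·log³ k)^{−k} times the max over size-k
subsets of V_1 ∪ … ∪ V_p.  (Equivalently, stated here: for every size-k subset S of
the union there is a size-k subset T of the union of the core-sets with
det_k(Σ_{v∈T} v vᵀ) ≥ (C'·k²·log³ k)^{−k} · det_k(Σ_{v∈S} v vᵀ).)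
-/

open Matrix Finset

noncomputable section

/-- `detk k A` is the sum of all `k × k` principal minors of `A`. -/
def detk {d : ℕ} (k : ℕ) (A : Matrix (Fin d) (Fin d) ℝ) : ℝ :=
  ∑ S ∈ Finset.powersetCard k (Finset.univ : Finset (Fin d)),
    Matrix.det (A.submatrix (fun i : {x // x ∈ S} => (i : Fin d))
      (fun j : {x // x ∈ S} => (j : Fin d)))


section helpers

open scoped RealInnerProductSpace

variable {E : Type*} [NormedAddCommGroup E] [InnerProductSpace ℝ E] [FiniteDimensional ℝ E]

/-- The distance of `x` from the subspace `G`. -/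
def hgt (G : Submodule ℝ E) (x : E) : ℝ := ‖Gᗮ.starProjection x‖

/-- Base times height squared formula for Gram determinants. -/
lemma det_gram_eq {n : ℕ} (f : Fin (n + 1) → E) (i : Fin (n + 1)) :
    (gram ℝ f).det = (gram ℝ (f ∘ i.succAbove)).det *
      hgt (Submodule.span ℝ (Set.image f {i}ᶜ)) (f i) ^ 2 := by
  set K := Submodule.span ℝ (Set.image f {i}ᶜ) with hK
  set w := Kᗮ.starProjection (f i) with hw
  have hwK : w ∈ Kᗮ := Submodule.starProjection_apply_mem _ _
  have hgK : f i - w ∈ K := by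
    have := Submodule.sub_starProjection_mem_orthogonal (K := Kᗮ) (f i)
    rwa [Submodule.orthogonal_orthogonal] at this
  have hzero : ∀ x ∈ K, ((gram ℝ f).updateRow i (fun j => ⟪x, f j⟫)).det = 0 := by
    intro x hx
    induction hx using Submodule.span_induction with
    | mem x hx =>
      obtain ⟨j, hj, rfl⟩ := hx
      have hj : j ≠ i := by simpa using hj
      refine Matrix.det_zero_of_row_eq hj ?_
      ext l
      rw [Matrix.updateRow_ne hj, Matrix.updateRow_self]
      rfl
    | zero =>
      refine Matrix.det_eq_zero_of_row_eq_zero i ?_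
      intro j
      simp
    | add x y _ _ hx hy =>
      have : (fun j => ⟪x + y, f j⟫) = (fun j => ⟪x, f j⟫) + (fun j => ⟪y, f j⟫) := by
        ext j; simp [inner_add_left]
      rw [this, Matrix.det_updateRow_add, hx, hy, add_zero]
    | smul a x _ hx =>
      have : (fun j => ⟪a • x, f j⟫) = a • (fun j => ⟪x, f j⟫) := by
        ext j; simp [inner_smul_left]
      rw [this, Matrix.det_updateRow_smul, hx, mul_zero]
  have h1 : (gram ℝ f).det = ((gram ℝ f).updateRow i (fun j => ⟪w, f j⟫)).det := by
    have h2 : (fun j => ⟪f i, f j⟫) = (fun j => ⟪w, f j⟫) + (fun j => ⟪f i - w, f j⟫) := by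
      ext j; simp [inner_sub_left]
    have h3 : gram ℝ f = (gram ℝ f).updateRow i (fun j => ⟪f i, f j⟫) := by
      conv_lhs => rw [← Matrix.updateRow_eq_self (gram ℝ f) i]
      rfl
    conv_lhs => rw [h3, h2, Matrix.det_updateRow_add, hzero _ hgK, add_zero]
  have hwi : ⟪w, f i⟫ = hgt K (f i) ^ 2 := by
    have : ⟪w, f i - w⟫ = 0 := Submodule.inner_left_of_mem_orthogonal hgK hwK
    rw [inner_sub_right, real_inner_self_eq_norm_sq] at this
    unfold hgt
    linarith
  rw [h1, Matrix.det_succ_row _ i, Finset.sum_eq_single i]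
  · rw [Matrix.updateRow_self, hwi]
    have : ((gram ℝ f).updateRow i (fun j => ⟪w, f j⟫)).submatrix i.succAbove i.succAbove =
        gram ℝ (f ∘ i.succAbove) := by
      ext a b
      simp [Matrix.updateRow_apply, Fin.succAbove_ne, gram_apply]
    rw [this, Even.neg_one_pow (Even.add_self (i : ℕ))]
    ring
  · intro j _ hj
    have : ⟪w, f j⟫ = 0 := Submodule.inner_left_of_mem_orthogonal
      (K := K) (Submodule.subset_span (Set.mem_image_of_mem f (by simpa using hj))) hwK
    rw [Matrix.updateRow_self, this]
    ring
  · simp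

lemma proj_sum {ι : Type*} [Fintype ι] (U : ι → E) (a : ι → ℝ) (i : ι) :
    (Submodule.span ℝ (Set.image U {i}ᶜ))ᗮ.starProjection (∑ j, a j • U j) =
      a i • (Submodule.span ℝ (Set.image U {i}ᶜ))ᗮ.starProjection (U i) := by
  classical
  rw [map_sum, Finset.sum_eq_single i]
  · simp
  · intro j _ hj
    rw [map_smul, Submodule.starProjection_orthogonal_apply_eq_zero, smul_zero]
    exact Submodule.subset_span ⟨j, by simpa using hj, rfl⟩
  · simp

lemma height_bound {ι : Type*} [Fintype ι] (U : ι → E) (hU : LinearIndependent ℝ U) (v : E)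
    (h : ∀ i, hgt (Submodule.span ℝ (Set.image U {i}ᶜ)) v ≤ hgt (Submodule.span ℝ (Set.image U {i}ᶜ)) (U i))
    (G : Submodule ℝ E)
    (hG : v ∈ Submodule.span ℝ (Set.range U) ∨ Module.finrank ℝ G < Fintype.card ι)
    (M : ℝ) (hM0 : 0 ≤ M) (hM : ∀ i, hgt G (U i) ≤ M) :
    hgt G v ≤ 2 * Fintype.card ι * M := by
  classical
  set W := Submodule.span ℝ (Set.range U) with hW
  set p := W.starProjection v with hp
  have hpW : p ∈ W := Submodule.starProjection_apply_mem _ _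
  obtain ⟨a, ha⟩ := (Submodule.mem_span_range_iff_exists_fun ℝ).1 hpW
  set w := v - p with hw
  have hwW : w ∈ Wᗮ := Submodule.sub_starProjection_mem_orthogonal v
  have hpos : ∀ i, 0 < hgt (Submodule.span ℝ (Set.image U {i}ᶜ)) (U i) := by
    intro i
    refine norm_pos_iff.2 fun h0 => ?_
    rw [Submodule.starProjection_apply_eq_zero_iff, Submodule.orthogonal_orthogonal] at h0
    have := hU.notMem_span_image (s := {i}ᶜ) (x := i) (by simp)
    exact this h0
  have hsq : ∀ i, hgt (Submodule.span ℝ (Set.image U {i}ᶜ)) v ^ 2 =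
      (a i) ^ 2 * hgt (Submodule.span ℝ (Set.image U {i}ᶜ)) (U i) ^ 2 + ‖w‖ ^ 2 := by
    intro i
    set K := Submodule.span ℝ (Set.image U {i}ᶜ) with hK
    have hKW : K ≤ W := Submodule.span_mono (Set.image_subset_range _ _)
    have hwK : Kᗮ.starProjection w = w :=
      Submodule.starProjection_eq_self_iff.2 (Submodule.orthogonal_le hKW hwW)
    have hv : v = p + w := by simp [hw]
    have hPp : Kᗮ.starProjection p = a i • Kᗮ.starProjection (U i) := by
      rw [← ha]; exact proj_sum U a i
    have horth : ⟪Kᗮ.starProjection p, w⟫ = 0 := by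
      rw [Submodule.inner_starProjection_left_eq_right, hwK]
      exact Submodule.inner_right_of_mem_orthogonal hpW hwW
    have : hgt K v = ‖Kᗮ.starProjection p + w‖ := by
      unfold hgt
      conv_lhs => rw [hv, map_add, hwK]
    rw [this, norm_add_sq_real, horth, hPp, norm_smul, mul_pow, Real.norm_eq_abs, sq_abs]
    unfold hgt
    ring
  have hsqle : ∀ i, (a i) ^ 2 * hgt (Submodule.span ℝ (Set.image U {i}ᶜ)) (U i) ^ 2 + ‖w‖ ^ 2 ≤
      hgt (Submodule.span ℝ (Set.image U {i}ᶜ)) (U i) ^ 2 := by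
    intro i
    rw [← hsq i]
    exact pow_le_pow_left₀ (norm_nonneg _) (h i) 2
  have hai : ∀ i, |a i| ≤ 1 := by
    intro i
    rw [← sq_le_one_iff_abs_le_one]
    have h1 := hsqle i
    have h2 := hpos i
    have h3 : 0 < hgt (Submodule.span ℝ (Set.image U {i}ᶜ)) (U i) ^ 2 := by positivity
    by_contra! h4
    nlinarith [sq_nonneg ‖w‖]
  have hwi : ∀ i, ‖w‖ ≤ hgt (Submodule.span ℝ (Set.image U {i}ᶜ)) (U i) := by
    intro i
    have h1 := hsqle i
    have h2 := hpos i
    refine le_of_sq_le_sq ?_ h2.le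
    nlinarith [mul_nonneg (sq_nonneg (a i)) (sq_nonneg (hgt (Submodule.span ℝ (Set.image U {i}ᶜ)) (U i)))]
  have hpart : hgt G p ≤ Fintype.card ι * M := by
    unfold hgt
    rw [← ha, map_sum]
    calc _ ≤ ∑ i, ‖Gᗮ.starProjection (a i • U i)‖ := norm_sum_le _ _
      _ ≤ ∑ i : ι, M := by
        refine Finset.sum_le_sum fun i _ => ?_
        rw [map_smul, norm_smul, Real.norm_eq_abs]
        calc |a i| * ‖Gᗮ.starProjection (U i)‖ ≤ 1 * M :=
              mul_le_mul (hai i) (hM i) (norm_nonneg _) zero_le_one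
          _ = M := one_mul _
      _ = _ := by simp
  have hwM : ‖w‖ ≤ Fintype.card ι * M := by
    rcases hG with hv | hG
    · have : w = 0 := by
        rw [hw, hp, Submodule.starProjection_eq_self_iff.2 hv, sub_self]
      rw [this, norm_zero]; positivity
    · have hfr : Module.finrank ℝ W = Fintype.card ι := finrank_span_eq_card hU
      have hker := LinearMap.ker_ne_bot_of_finrank_lt
        (f := (G.orthogonalProjectionOnto : E →ₗ[ℝ] G).comp W.subtype) (by rwa [hfr])
      obtain ⟨⟨x, hxW⟩, hx, hx0⟩ := Submodule.exists_mem_ne_zero_of_ne_bot hker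
      have hx0 : x ≠ 0 := by simpa using hx0
      have hxG : x ∈ Gᗮ := by
        rw [← Submodule.orthogonalProjectionOnto_eq_zero_iff]
        simpa using hx
      obtain ⟨b, hb⟩ := (Submodule.mem_span_range_iff_exists_fun ℝ).1 hxW
      have hbi : ∀ i, |b i| * ‖w‖ ≤ ‖x‖ := by
        intro i
        calc |b i| * ‖w‖ ≤ |b i| * hgt (Submodule.span ℝ (Set.image U {i}ᶜ)) (U i) :=
              mul_le_mul_of_nonneg_left (hwi i) (abs_nonneg _)
          _ = ‖(Submodule.span ℝ (Set.image U {i}ᶜ))ᗮ.starProjection x‖ := by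
              rw [← hb, proj_sum, norm_smul, Real.norm_eq_abs]; rfl
          _ ≤ ‖x‖ := Submodule.norm_starProjection_apply_le _ _
      have hxU : ∀ i, |⟪x, U i⟫| ≤ ‖x‖ * M := by
        intro i
        have : ⟪x, U i⟫ = ⟪x, Gᗮ.starProjection (U i)⟫ := by
          rw [← Submodule.inner_starProjection_left_eq_right,
            Submodule.starProjection_eq_self_iff.2 hxG]
        rw [this]
        exact (abs_real_inner_le_norm _ _).trans
          (mul_le_mul_of_nonneg_left (hM i) (norm_nonneg _))
      have hxx : ‖x‖ ^ 2 = ∑ i, b i * ⟪x, U i⟫ := by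
        rw [← real_inner_self_eq_norm_sq]
        conv_lhs => rw [← hb, inner_sum, hb]
        simp [inner_smul_right]
      have hfin : ‖x‖ ^ 2 * ‖w‖ ≤ ‖x‖ ^ 2 * (Fintype.card ι * M) := by
        calc ‖x‖ ^ 2 * ‖w‖ = ∑ i, b i * ⟪x, U i⟫ * ‖w‖ := by rw [hxx, Finset.sum_mul]
          _ ≤ ∑ i : ι, ‖x‖ * (‖x‖ * M) := by
            refine Finset.sum_le_sum fun i _ => ?_
            calc b i * ⟪x, U i⟫ * ‖w‖ ≤ |b i * ⟪x, U i⟫| * ‖w‖ :=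
                  mul_le_mul_of_nonneg_right (le_abs_self _) (norm_nonneg _)
              _ = (|b i| * ‖w‖) * |⟪x, U i⟫| := by rw [abs_mul]; ring
              _ ≤ ‖x‖ * (‖x‖ * M) :=
                  mul_le_mul (hbi i) (hxU i) (abs_nonneg _) (norm_nonneg _)
          _ = _ := by simp; ring
      exact le_of_mul_le_mul_left hfin (by positivity)
  have hv : v = p + w := by simp [hw]
  calc hgt G v ≤ hgt G p + hgt G w := by
        unfold hgt
        conv_lhs => rw [hv, map_add]
        exact norm_add_le _ _
    _ ≤ hgt G p + ‖w‖ := by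
        have := Submodule.norm_starProjection_apply_le Gᗮ w
        unfold hgt
        linarith
    _ ≤ _ := by linarith

/-- Existence of a core-set preserving all directional heights. -/
lemma exists_coreset {α : Type*} [DecidableEq α] (e : α → E) (k : ℕ) (hk : 1 ≤ k)
    (V : Finset α) :
    ∃ c ⊆ V, c.card = min V.card k ∧ ∀ G : Submodule ℝ E, Module.finrank ℝ G < k →
      ∀ v ∈ V, ∃ u ∈ c, hgt G (e v) ≤ 2 * k * hgt G (e u) := by
  classical
  let P : ℕ → Prop := fun r => ∃ f : Fin r → V, LinearIndependent ℝ (fun i => e (f i))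
  have hP0 : P 0 := ⟨Fin.elim0, linearIndependent_empty_type⟩
  set r := Nat.findGreatest P k with hr
  have hPr : P r := Nat.findGreatest_spec (Nat.zero_le k) hP0
  have hrk : r ≤ k := Nat.findGreatest_le k
  obtain ⟨f0, hf0⟩ := hPr
  have : Nonempty (Fin r → V) := ⟨f0⟩
  obtain ⟨f, hf⟩ := Finite.exists_max (fun f : Fin r → V => (gram ℝ (fun i => e (f i))).det)
  have hfpos : 0 < (gram ℝ (fun i => e (f i))).det :=
    lt_of_lt_of_le (posDef_gram_of_linearIndependent hf0).det_pos (hf f0)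
  have hfli : LinearIndependent ℝ (fun i => e (f i)) :=
    linearIndependent_of_det_gram_ne_zero hfpos.ne'
  let c0 : Finset α := Finset.univ.image (fun i => (f i : α))
  have hc0V : c0 ⊆ V := by
    intro x hx
    obtain ⟨i, _, rfl⟩ := Finset.mem_image.1 hx
    exact (f i).2
  have hc0r : c0.card ≤ k := by
    refine Finset.card_image_le.trans ?_
    simpa using hrk
  obtain ⟨c, hc0c, hcV, hcard⟩ := Finset.exists_subsuperset_card_eq hc0V
    (le_min (Finset.card_le_card hc0V) hc0r) (min_le_left V.card k)
  refine ⟨c, hcV, hcard, fun G hG v hv => ?_⟩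
  have hcne : c.Nonempty := by
    rw [← Finset.card_pos, hcard]
    exact lt_min (Finset.card_pos.2 ⟨v, hv⟩) hk
  obtain ⟨u, hu, humax⟩ := Finset.exists_max_image c (fun u => hgt G (e u)) hcne
  refine ⟨u, hu, ?_⟩
  have hmain := height_bound (fun i => e (f i)) hfli (e v) ?_ G ?_ (hgt G (e u)) (norm_nonneg _)
    (fun i => humax _ (hc0c (Finset.mem_image.2 ⟨i, Finset.mem_univ _, rfl⟩)))
  · refine hmain.trans ?_
    rw [Fintype.card_fin]
    have : (r : ℝ) ≤ k := by exact_mod_cast hrk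
    have h0 : 0 ≤ hgt G (e u) := norm_nonneg _
    gcongr
  · clear_value r
    intro i
    cases r with
    | zero => exact i.elim0
    | succ n =>
      have hle := hf (Function.update f i ⟨v, hv⟩)
      rw [det_gram_eq _ i, det_gram_eq (fun j => e (f j)) i] at hle
      have e1 : (fun j => e ((Function.update f i ⟨v, hv⟩) j)) ∘ i.succAbove =
          (fun j => e (f j)) ∘ i.succAbove := by
        ext j
        simp [Fin.succAbove_ne]
      have e2 : Set.image (fun j => e ((Function.update f i ⟨v, hv⟩) j)) {i}ᶜ =
          Set.image (fun j => e (f j)) {i}ᶜ := by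
        refine Set.image_congr fun j hj => ?_
        have hj : j ≠ i := by simpa using hj
        simp [hj]
      rw [e1, e2] at hle
      simp only [Function.update_self] at hle
      have hpos : 0 < (gram ℝ ((fun j => e (f j)) ∘ i.succAbove)).det :=
        (posDef_gram_of_linearIndependent
          (hfli.comp _ Fin.succAbove_right_injective)).det_pos
      exact le_of_sq_le_sq (le_of_mul_le_mul_left hle hpos) (norm_nonneg _)
  · by_cases hrk' : r = k
    · right; rw [Fintype.card_fin, hrk']; exact hG
    · left
      by_contra hvn
      have hlt : r < k := lt_of_le_of_ne hrk hrk'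
      have hnot : ¬ P (r + 1) := Nat.findGreatest_is_greatest (Nat.lt_succ_self r) hlt
      refine hnot ⟨Fin.cons ⟨v, hv⟩ f, ?_⟩
      have : (fun i => e ((Fin.cons (⟨v, hv⟩ : V) f : Fin (r + 1) → V) i)) =
          (Fin.cons (e v) (fun i => e (f i)) : Fin (r + 1) → E) := by
        ext i
        refine Fin.cases ?_ (fun j => ?_) i <;> simp
      rw [this]
      exact linearIndependent_finCons.2 ⟨hfli, hvn⟩

lemma exchange {α : Type*} (e : α → E) (n : ℕ) (f : Fin (n + 1) → α)
    (R : Fin (n + 1) → Finset α)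
    (hR : ∀ i, ∀ G : Submodule ℝ E, Module.finrank ℝ G < n + 1 →
      ∃ u ∈ R i, hgt G (e (f i)) ≤ 2 * ((n + 1 : ℕ) : ℝ) * hgt G (e u))
    (s : Finset (Fin (n + 1))) :
    ∃ g : Fin (n + 1) → α, (∀ i ∈ s, g i ∈ R i) ∧ (∀ i ∉ s, g i = f i) ∧
      (gram ℝ (fun i => e (f i))).det ≤
        (4 * ((n + 1 : ℕ) : ℝ) ^ 2) ^ s.card * (gram ℝ (fun i => e (g i))).det := by
  classical
  induction s using Finset.induction_on with
  | empty => exact ⟨f, by simp, by simp, by simp⟩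
  | insert i s hi ih =>
    obtain ⟨g, hg1, hg2, hg3⟩ := ih
    have hfr : Module.finrank ℝ (Submodule.span ℝ (Set.image (fun j => e (g j)) {i}ᶜ)) < n + 1 := by
      have : Set.image (fun j => e (g j)) {i}ᶜ = Set.range ((fun j => e (g j)) ∘ i.succAbove) := by
        rw [Set.range_comp, Fin.range_succAbove]
      rw [this]
      have := finrank_range_le_card (R := ℝ) ((fun j => e (g j)) ∘ i.succAbove)
      rw [Fintype.card_fin] at this
      exact Nat.lt_succ_of_le this
    obtain ⟨u, hu, hub⟩ := hR i _ hfr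
    refine ⟨Function.update g i u, ?_, ?_, ?_⟩
    · intro j hj
      by_cases hji : j = i
      · subst hji; simpa using hu
      · rw [Function.update_of_ne hji]
        exact hg1 j ((Finset.mem_insert.1 hj).resolve_left hji)
    · intro j hj
      rw [Finset.mem_insert, not_or] at hj
      rw [Function.update_of_ne hj.1]
      exact hg2 j hj.2
    · rw [Finset.card_insert_of_notMem hi, pow_succ, mul_assoc]
      refine hg3.trans (mul_le_mul_of_nonneg_left ?_ (by positivity))
      rw [det_gram_eq _ i, det_gram_eq (fun j => e (Function.update g i u j)) i]
      have e1 : (fun j => e (Function.update g i u j)) ∘ i.succAbove =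
          (fun j => e (g j)) ∘ i.succAbove := by
        ext j
        simp [Fin.succAbove_ne]
      have e2 : Set.image (fun j => e (Function.update g i u j)) {i}ᶜ =
          Set.image (fun j => e (g j)) {i}ᶜ := by
        refine Set.image_congr fun j hj => ?_
        have hj : j ≠ i := by simpa using hj
        simp [hj]
      rw [e1, e2]
      simp only [Function.update_self]
      rw [hg2 i hi]
      have h0 : 0 ≤ (gram ℝ ((fun j => e (g j)) ∘ i.succAbove)).det :=
        (posSemidef_gram ℝ _).det_nonneg
      have h2 := pow_le_pow_left₀ (norm_nonneg _) hub 2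
      calc _ ≤ _ := mul_le_mul_of_nonneg_left h2 h0
        _ = _ := by ring

end helpers

open Polynomial in
lemma detk_eq_gram {d k : ℕ} (g : Fin k → (Fin d → ℝ)) :
    detk k (∑ i, outer (g i)) = (gram ℝ (fun i => WithLp.toLp 2 (g i))).det := by
  set A : Matrix (Fin k) (Fin d) ℝ := Matrix.of g with hA
  have h1 : ∑ i, outer (g i) = Aᵀ * A := by
    ext a b
    simp [Matrix.sum_apply, outer, Matrix.vecMulVec_apply, Matrix.mul_apply, hA]
  have h2 : gram ℝ (fun i => WithLp.toLp 2 (g i)) = A * Aᵀ := by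
    ext a b
    simp [gram_apply, Matrix.mul_apply, hA, PiLp.inner_apply, mul_comm]
  rw [h1, h2]
  have h3 : detk k (Aᵀ * A) = (det (1 + (X : ℝ[X]) • (Aᵀ * A).map C)).coeff k :=
    (Matrix.coeff_det_one_add_X_smul_eq_sum_minors _ k).symm
  have h4 : (det (1 + (X : ℝ[X]) • (Aᵀ * A).map C)) =
      det (1 + (X : ℝ[X]) • (A * Aᵀ).map C) := by
    rw [Matrix.map_mul, Matrix.map_mul, ← Matrix.smul_mul, Matrix.det_one_add_mul_comm,
      Matrix.mul_smul]
  rw [h3, h4, Matrix.coeff_det_one_add_X_smul_eq_sum_minors]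
  have h5 : (Finset.univ : Finset (Fin k)).powersetCard k = {Finset.univ} := by
    have := Finset.powersetCard_self (Finset.univ : Finset (Fin k))
    rwa [Finset.card_univ, Fintype.card_fin] at this
  rw [h5, Finset.sum_singleton]
  convert Matrix.det_submatrix_equiv_self
    (Equiv.subtypeUnivEquiv (fun x => Finset.mem_univ x)) (A * Aᵀ) <;> rfl

lemma sum_image_outer {d k : ℕ} (g : Fin k → (Fin d → ℝ)) (hg : Function.Injective g) :
    ∑ v ∈ Finset.univ.image g, outer v = ∑ i, outer (g i) :=
  Finset.sum_image (fun _ _ _ _ h => hg h)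

theorem composable_coreset_for_determinant_maximization :
    ∃ C > (0:ℝ), ∃ C' > (0:ℝ), ∀ d k : ℕ, 2 ≤ k → k ≤ d →
      ∃ c : Finset (Fin d → ℝ) → Finset (Fin d → ℝ),
        (∀ V, c V ⊆ V) ∧
        (∀ V, ((c V).card : ℝ) ≤ C * k * (Real.log k) ^ 2) ∧
        ∀ (p : ℕ) (V : Fin p → Finset (Fin d → ℝ)),
          ∀ S ⊆ Finset.univ.biUnion V, S.card = k →
            ∃ T ⊆ Finset.univ.biUnion (fun i => c (V i)), T.card = k ∧
              (C' * (k:ℝ) ^ 2 * (Real.log k) ^ 3)⁻¹ ^ k * detk k (∑ v ∈ S, outer v) ≤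
                detk k (∑ v ∈ T, outer v) := by
  classical
  have hl2 : (0.69 : ℝ) < Real.log 2 := by have := Real.log_two_gt_d9; linarith
  refine ⟨100, by norm_num, 100, by norm_num, fun d k hk hkd => ?_⟩
  have hlog : (0.69 : ℝ) < Real.log k :=
    hl2.trans_le (Real.log_le_log (by norm_num) (by exact_mod_cast hk))
  have hk0 : (0 : ℝ) < k := by exact_mod_cast (by omega : 0 < k)
  let e : (Fin d → ℝ) → EuclideanSpace ℝ (Fin d) := fun v => WithLp.toLp 2 v
  choose c hcV hcard hc using exists_coreset e k (by omega)
  refine ⟨c, hcV, fun V => ?_, fun p V S hS hSk => ?_⟩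
  · have h1 : ((c V).card : ℝ) ≤ k := by
      rw [hcard V]; exact_mod_cast min_le_right _ _
    have h2 : (0.69 : ℝ) ^ 2 ≤ Real.log k ^ 2 :=
      pow_le_pow_left₀ (by norm_num) hlog.le 2
    nlinarith
  have hcoef : (4 * (k : ℝ) ^ 2) ≤ 100 * (k : ℝ) ^ 2 * Real.log k ^ 3 := by
    have h3 : (0.69 : ℝ) ^ 3 ≤ Real.log k ^ 3 := pow_le_pow_left₀ (by norm_num) hlog.le 3
    have : 0 < (k : ℝ) ^ 2 := by positivity
    nlinarith
  have hcpos : (0 : ℝ) < 100 * (k : ℝ) ^ 2 * Real.log k ^ 3 := lt_of_lt_of_le (by positivity) hcoef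
  -- enumerate S
  let φ : Fin k ≃ S := (S.equivFinOfCardEq hSk).symm
  let f : Fin k → (Fin d → ℝ) := fun i => (φ i : Fin d → ℝ)
  have hfinj : Function.Injective f := Subtype.val_injective.comp φ.injective
  have hfS : Finset.univ.image f = S := by
    ext x
    simp only [Finset.mem_image, Finset.mem_univ, true_and]
    constructor
    · rintro ⟨i, rfl⟩; exact (φ i).2
    · intro hx; exact ⟨φ.symm ⟨x, hx⟩, by simp [f]⟩
  have hdS : detk k (∑ v ∈ S, outer v) = (gram ℝ (fun i => e (f i))).det := by
    rw [← hfS, sum_image_outer f hfinj, detk_eq_gram]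
  by_cases hzero : (gram ℝ (fun i => e (f i))).det = 0
  · -- degenerate case
    have hcardU : k ≤ (Finset.univ.biUnion (fun i => c (V i))).card := by
      by_cases hbig : ∃ i, k ≤ (V i).card
      · obtain ⟨i, hi⟩ := hbig
        calc k = (c (V i)).card := by rw [hcard, min_eq_right hi]
          _ ≤ _ := Finset.card_le_card
            (Finset.subset_biUnion_of_mem (fun i => c (V i)) (Finset.mem_univ i))
      · push Not at hbig
        have : ∀ i, c (V i) = V i := fun i =>
          Finset.eq_of_subset_of_card_le (hcV _) (by rw [hcard, min_eq_left (hbig i).le])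
        simp only [this]
        rw [← hSk]
        exact Finset.card_le_card hS
    obtain ⟨T, hT, hTk⟩ := Finset.exists_subset_card_eq hcardU
    refine ⟨T, hT, hTk, ?_⟩
    rw [hdS, hzero, mul_zero]
    let ψ : Fin k ≃ T := (T.equivFinOfCardEq hTk).symm
    have hinj : Function.Injective (fun i => (ψ i : Fin d → ℝ)) :=
      Subtype.val_injective.comp ψ.injective
    have hT' : Finset.univ.image (fun i => (ψ i : Fin d → ℝ)) = T := by
      ext x
      simp only [Finset.mem_image, Finset.mem_univ, true_and]
      constructor
      · rintro ⟨i, rfl⟩; exact (ψ i).2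
      · intro hx; exact ⟨ψ.symm ⟨x, hx⟩, by simp⟩
    rw [← hT', sum_image_outer _ hinj, detk_eq_gram]
    exact (posSemidef_gram ℝ _).det_nonneg
  · have hpos : 0 < (gram ℝ (fun i => e (f i))).det :=
      lt_of_le_of_ne (posSemidef_gram ℝ _).det_nonneg (Ne.symm hzero)
    have hj : ∀ i, ∃ j, f i ∈ V j := by
      intro i
      have := hS (φ i).2
      simpa using this
    choose j hj using hj
    obtain ⟨g, hg1, -, hg3⟩ : ∃ g : Fin k → (Fin d → ℝ),
        (∀ i ∈ Finset.univ, g i ∈ c (V (j i))) ∧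
        (∀ i ∉ (Finset.univ : Finset (Fin k)), g i = f i) ∧
        (gram ℝ (fun i => e (f i))).det ≤
          (4 * (k : ℝ) ^ 2) ^ (Finset.univ : Finset (Fin k)).card *
            (gram ℝ (fun i => e (g i))).det := by
      clear_value f
      clear hdS hfS φ
      obtain ⟨n, rfl⟩ : ∃ n, k = n + 1 := ⟨k - 1, by omega⟩
      exact exchange e n f (fun i => c (V (j i)))
        (fun i G hG => hc (V (j i)) G hG (f i) (hj i)) Finset.univ
    rw [Finset.card_univ, Fintype.card_fin] at hg3
    have hgpos : 0 < (gram ℝ (fun i => e (g i))).det := by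
      by_contra! hneg
      have : (4 * (k : ℝ) ^ 2) ^ k * (gram ℝ (fun i => e (g i))).det ≤ 0 :=
        mul_nonpos_of_nonneg_of_nonpos (by positivity) hneg
      linarith
    have hginj : Function.Injective g := by
      have hli := (linearIndependent_of_det_gram_ne_zero hgpos.ne').injective
      intro a b hab
      exact hli (by simp [hab])
    refine ⟨Finset.univ.image g, ?_, ?_, ?_⟩
    · intro x hx
      obtain ⟨i, hi, rfl⟩ := Finset.mem_image.1 hx
      exact Finset.mem_biUnion.2 ⟨j i, Finset.mem_univ _, hg1 i hi⟩
    · rw [Finset.card_image_of_injective _ hginj, Finset.card_univ, Fintype.card_fin]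
    · rw [hdS, sum_image_outer g hginj, detk_eq_gram, inv_pow,
        inv_mul_le_iff₀ (pow_pos hcpos k)]
      refine hg3.trans (mul_le_mul_of_nonneg_right ?_ hgpos.le)
      exact pow_le_pow_left₀ (by positivity) hcoef k
end
end
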